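/- Let ν be an integrable measure on ℝⁿ. Then ν is universal on the space ℳ^int_unc(A_{[n]}) of integrable unconditional measures concentrated on A_{[n]} if and only if M_unc(ν) has degree n, i.e. (M_unc(ν))_{[n]} ≠ 0. -/

import Mathlib

open MeasureTheory
open scoped ENNReal symmDiff Classical

noncomputable section

/-- The Euclidean (ℓ²) norm on `Fin n → ℝ`. -/
def e2 {n : ℕ} (x : Fin n → ℝ) : ℝ := Real.sqrt (∑ i, (x i) ^ 2)

/-- The unit sphere `S^{n-1}` in `ℝⁿ`. -/
def Sph (n : ℕ) : Set (Fin n → ℝ) := {x | e2 x = 1}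

/-- The set `A_E = {x : xᵢ ≠ 0 ↔ i ∈ E}`. -/
def setA {n : ℕ} (E : Finset (Fin n)) : Set (Fin n → ℝ) := {x | ∀ i, x i ≠ 0 ↔ i ∈ E}

/-- Finite signed Borel measures on `ℝⁿ`. -/
abbrev SM (n : ℕ) := MeasureTheory.SignedMeasure (Fin n → ℝ)

/-- A (finite) measure regarded as a signed measure (junk value `0` if not finite). -/
def toSigned {X : Type*} [MeasurableSpace X] (ρ : Measure X) : SignedMeasure X :=
  if h : IsFiniteMeasure ρ then @Measure.toSignedMeasure X _ ρ h else 0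

/-- Multiplicative convolution of two non-negative measures. -/
def mconvPos {n : ℕ} (ρ σ : Measure (Fin n → ℝ)) : Measure (Fin n → ℝ) :=
  (ρ.prod σ).map (fun p => p.1 * p.2)

/-- Multiplicative convolution `μ ⊛ ν` of two signed measures, via Jordan decomposition. -/
def mconv {n : ℕ} (μ ν : SM n) : SM n :=
  toSigned (mconvPos μ.toJordanDecomposition.posPart ν.toJordanDecomposition.posPart
      + mconvPos μ.toJordanDecomposition.negPart ν.toJordanDecomposition.negPart)
  - toSigned (mconvPos μ.toJordanDecomposition.posPart ν.toJordanDecomposition.negPart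
      + mconvPos μ.toJordanDecomposition.negPart ν.toJordanDecomposition.posPart)

/-- `μ` is integrable: `∫ ‖x‖₂ d|μ| < ∞`. -/
def IntegrableSM {n : ℕ} (μ : SM n) : Prop :=
  ∫⁻ x, ENNReal.ofReal (e2 x) ∂μ.totalVariation < ⊤

/-- `μ` is concentrated on `A`:  `|μ|(Aᶜ) = 0`. -/
def ConcOn {n : ℕ} (μ : SM n) (A : Set (Fin n → ℝ)) : Prop := μ.totalVariation Aᶜ = 0

/-- The multiple reflection `T_E` on `ℝⁿ`. -/
def flipE {n : ℕ} (E : Finset (Fin n)) (x : Fin n → ℝ) : Fin n → ℝ :=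
  fun i => if i ∈ E then -x i else x i

/-- Pushforward of a signed measure under `T_E`. -/
def Tmap {n : ℕ} (E : Finset (Fin n)) (μ : SM n) : SM n := μ.map (flipE E)

def EvenUnder {n : ℕ} (μ : SM n) (E : Finset (Fin n)) : Prop := Tmap E μ = μ
def OddUnder {n : ℕ} (μ : SM n) (E : Finset (Fin n)) : Prop := Tmap E μ = -μ

/-- Orthogonal projection onto the coordinate subspace `H_E`. -/
def projE {n : ℕ} (E : Finset (Fin n)) (x : Fin n → ℝ) : Fin n → ℝ :=
  fun i => if i ∈ E then x i else 0

/-- `P_E(μ)`: pushforward under `projE`. -/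
def Pmap {n : ℕ} (E : Finset (Fin n)) (μ : SM n) : SM n := μ.map (projE E)

/-- `R_E(μ) = μ_E`: restriction to `A_E`. -/
def Rres {n : ℕ} (E : Finset (Fin n)) (μ : SM n) : SM n := μ.restrict (setA E)

/-- Sign vector attached to `b : Fin n → Bool`. -/
def signVec {n : ℕ} (b : Fin n → Bool) : Fin n → ℝ := fun i => if b i then 1 else -1

/-- The measure `δ_J = 2^{-n} ∑_{s ∈ 𝒮ⁿ} σ_J(s) δ_s`. -/
def deltaJ {n : ℕ} (J : Finset (Fin n)) : SM n :=
  ((2 : ℝ) ^ n)⁻¹ •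
    ∑ b : Fin n → Bool,
      (∏ j ∈ J, (if b j then (1 : ℝ) else -1)) • toSigned (Measure.dirac (signVec b))

/-- `𝒥(E; Fe, Fo)`. -/
def JsetE {n : ℕ} (E : Finset (Fin n)) (Fe Fo : Set (Finset (Fin n))) :
    Set (Finset (Fin n)) :=
  {J | J ⊆ E ∧ (∀ F ∈ Fe, Even (J ∩ F).card) ∧ (∀ F ∈ Fo, Odd (J ∩ F).card)}

/-- `𝒥(Fe, Fo) = 𝒥([n]; Fe, Fo)`. -/
def Jset {n : ℕ} (Fe Fo : Set (Finset (Fin n))) : Set (Finset (Fin n)) :=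
  {J | (∀ F ∈ Fe, Even (J ∩ F).card) ∧ (∀ F ∈ Fo, Odd (J ∩ F).card)}

/-- `G` has a representation `G = F₁ Δ … Δ F_m` with each `Fᵢ` drawn from `Fe` or `Fo`,
in which the number of terms drawn from `Fo` is even (`odd = false`) or odd (`odd = true`). -/
def HasRep {n : ℕ} (Fe Fo : Set (Finset (Fin n))) (G : Finset (Fin n)) (odd : Bool) : Prop :=
  ∃ l : List (Finset (Fin n) × Bool),
    (∀ p ∈ l, if p.2 then p.1 ∈ Fo else p.1 ∈ Fe) ∧
    (l.map Prod.fst).foldr (· ∆ ·) ∅ = G ∧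
    (l.countP (fun p => p.2)) % 2 = (if odd then 1 else 0)

/-- The generating pair `(Fe, Fo)` is proper: the even and odd parts of the generated group
are disjoint. -/
def ProperPair {n : ℕ} (Fe Fo : Set (Finset (Fin n))) : Prop :=
  ∀ G : Finset (Fin n), ¬ (HasRep Fe Fo G false ∧ HasRep Fe Fo G true)

/-- `ℳ^int(A; Fe, Fo)`: integrable signed measures concentrated on `A`, even under `T_F`
for `F ∈ Fe` and odd under `T_F` for `F ∈ Fo`. -/
def MclassInt {n : ℕ} (A : Set (Fin n → ℝ)) (Fe Fo : Set (Finset (Fin n))) : Set (SM n) :=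
  {μ | IntegrableSM μ ∧ ConcOn μ A ∧ (∀ F ∈ Fe, EvenUnder μ F) ∧ (∀ F ∈ Fo, OddUnder μ F)}

/-- `ν` is universal on `𝒜`. -/
def Universal {n : ℕ} (ν : SM n) (𝒜 : Set (SM n)) : Prop :=
  ∀ μ ∈ 𝒜, mconv ν μ = 0 → μ = 0

/-- Radial projection of a non-negative measure. -/
def radPos {n : ℕ} (ρ : Measure (Fin n → ℝ)) : Measure (Fin n → ℝ) :=
  (ρ.withDensity fun x => ENNReal.ofReal (e2 x)).map (fun x => (e2 x)⁻¹ • x)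

/-- Radial projection `P_S` of a signed measure. -/
def PS {n : ℕ} (μ : SM n) : SM n :=
  toSigned (radPos μ.toJordanDecomposition.posPart) -
    toSigned (radPos μ.toJordanDecomposition.negPart)

/-- The spherical product `μ ⊛_S ν = P_S(μ ⊛ ν)`. -/
def mconvS {n : ℕ} (μ ν : SM n) : SM n := PS (mconv μ ν)

/-- `ν` is spherically universal on `𝒜`. -/
def SphUniversal {n : ℕ} (ν : SM n) (𝒜 : Set (SM n)) : Prop :=
  ∀ μ ∈ 𝒜, mconvS ν μ = 0 → μ = 0

/-- The unconditional symmetrisation `M_unc`. -/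
def Munc {n : ℕ} (μ : SM n) : SM n := ((2 : ℝ) ^ n)⁻¹ • ∑ E : Finset (Fin n), Tmap E μ

/-- Integral of `f` against a signed measure. -/
def sInt {n : ℕ} (μ : SM n) (f : (Fin n → ℝ) → ℝ) : ℝ :=
  (∫ x, f x ∂μ.toJordanDecomposition.posPart) - ∫ x, f x ∂μ.toJordanDecomposition.negPart

/-- `δ₁ ⊗ μ`: the lifting of `μ` to a measure on `ℝ^{n+1}`, with an extra `0`-th coordinate
carrying a unit atom at `1`. -/
def lift0 {n : ℕ} (μ : SM n) : SM (n + 1) := μ.map (fun x => Fin.cons 1 x)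

/-- Symmetrisation about the origin. -/
def Msym {n : ℕ} (μ : SM n) : SM n := (2 : ℝ)⁻¹ • (μ + μ.map (fun x => -x))

/-- The lifting `L(μ) = P_S(M_sym(δ₁ ⊗ μ))`. -/
def Lift {n : ℕ} (μ : SM n) : SM (n + 1) := PS (Msym (lift0 μ))


/-- The multiplicative weight `∏ᵢ |xᵢ|^{bᵢ}`. -/
def powWeight {n : ℕ} (b x : Fin n → ℝ) : ℝ := ∏ i, |x i| ^ b i

/-- The exponents `b` with all coordinates in `(0, 1/n)`; integrable measures integrate
`powWeight b` for these. -/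
def expBox (n : ℕ) : Set (Fin n → ℝ) := Set.univ.pi fun _ => Set.Ioo 0 (n : ℝ)⁻¹

/-- The coordinatewise logarithm `i ↦ log |xᵢ|`. -/
def logVec {n : ℕ} (x : Fin n → ℝ) : Fin n → ℝ := fun i => Real.log (x i)

/-- The measure with density `powWeight b` with respect to `ρ`. -/
def tilt {n : ℕ} (ρ : Measure (Fin n → ℝ)) (b : Fin n → ℝ) : Measure (Fin n → ℝ) :=
  ρ.withDensity fun x => ENNReal.ofReal (powWeight b x)

section Weights

variable {n : ℕ}

lemma powWeight_nonneg (b x : Fin n → ℝ) : 0 ≤ powWeight b x :=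
  Finset.prod_nonneg fun _ _ => Real.rpow_nonneg (abs_nonneg _) _

lemma measurable_powWeight (b : Fin n → ℝ) : Measurable (powWeight b) := by
  unfold powWeight
  fun_prop

lemma powWeight_mul (b x y : Fin n → ℝ) :
    powWeight b (x * y) = powWeight b x * powWeight b y := by
  simp only [powWeight, ← Finset.prod_mul_distrib, Pi.mul_apply, abs_mul]
  exact Finset.prod_congr rfl fun i _ => Real.mul_rpow (abs_nonneg _) (abs_nonneg _)

lemma powWeight_pos {b x : Fin n → ℝ} (hx : ∀ i, x i ≠ 0) : 0 < powWeight b x :=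
  Finset.prod_pos fun i _ => Real.rpow_pos_of_pos (abs_pos.2 (hx i)) _

lemma powWeight_eq_zero {b x : Fin n → ℝ} (hb : b ∈ expBox n) (hx : ¬ ∀ i, x i ≠ 0) :
    powWeight b x = 0 := by
  push Not at hx
  obtain ⟨i, hi⟩ := hx
  refine Finset.prod_eq_zero (Finset.mem_univ i) ?_
  rw [hi, abs_zero, Real.zero_rpow (hb i trivial).1.ne']

lemma isOpen_expBox : IsOpen (expBox n) := isOpen_set_pi Set.finite_univ fun _ _ => isOpen_Ioo

lemma convex_expBox : Convex ℝ (expBox n) := convex_pi fun _ _ => convex_Ioo _ _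

lemma abs_le_e2 (x : Fin n → ℝ) (i : Fin n) : |x i| ≤ e2 x := by
  rw [e2, ← Real.sqrt_sq_eq_abs]
  exact Real.sqrt_le_sqrt
    (Finset.single_le_sum (f := fun i => x i ^ 2) (fun i _ => sq_nonneg _) (Finset.mem_univ i))

lemma measurable_e2 : Measurable (e2 : (Fin n → ℝ) → ℝ) := by
  unfold e2
  fun_prop

lemma e2_nonneg (x : Fin n → ℝ) : 0 ≤ e2 x := Real.sqrt_nonneg _

lemma powWeight_le {b : Fin n → ℝ} (hb : b ∈ expBox n) (x : Fin n → ℝ) :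
    powWeight b x ≤ 1 + e2 x := by
  have h0 : 0 ≤ e2 x := e2_nonneg x
  have h1 : powWeight b x ≤ (1 + e2 x) ^ ∑ i, b i := by
    rw [Real.rpow_sum_of_pos (by positivity)]
    refine Finset.prod_le_prod (fun i _ => Real.rpow_nonneg (abs_nonneg _) _) fun i _ => ?_
    exact Real.rpow_le_rpow (abs_nonneg _) (by linarith [abs_le_e2 x i]) (hb i trivial).1.le
  have h2 : ∑ i, b i ≤ 1 := by
    rcases Nat.eq_zero_or_pos n with rfl | hn
    · simp
    calc ∑ i, b i ≤ ∑ _i : Fin n, (n : ℝ)⁻¹ := Finset.sum_le_sum fun i _ => (hb i trivial).2.le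
      _ = 1 := by
        have : (n : ℝ) ≠ 0 := by positivity
        simp [this]
  calc powWeight b x ≤ _ := h1
    _ ≤ (1 + e2 x) ^ (1 : ℝ) := Real.rpow_le_rpow_of_exponent_le (by linarith) h2
    _ = _ := Real.rpow_one _

lemma integrable_powWeight {ρ : Measure (Fin n → ℝ)} [IsFiniteMeasure ρ]
    (hρ : ∫⁻ x, ENNReal.ofReal (e2 x) ∂ρ < ⊤) {b : Fin n → ℝ} (hb : b ∈ expBox n) :
    Integrable (powWeight b) ρ := by
  have he : Integrable e2 ρ := by
    refine ⟨measurable_e2.aestronglyMeasurable, ?_⟩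
    rw [hasFiniteIntegral_iff_ofReal (Filter.Eventually.of_forall e2_nonneg)]
    exact hρ
  refine ((integrable_const (1 : ℝ)).add he).mono' (measurable_powWeight b).aestronglyMeasurable ?_
  refine Filter.Eventually.of_forall fun x => ?_
  rw [Real.norm_of_nonneg (powWeight_nonneg b x)]
  exact powWeight_le hb x

lemma measurable_logVec : Measurable (logVec : (Fin n → ℝ) → Fin n → ℝ) :=
  measurable_pi_lambda _ fun i => Real.measurable_log.comp (measurable_pi_apply i)

lemma powWeight_add {b d : Fin n → ℝ} (hb : b ∈ expBox n) (hbd : b + d ∈ expBox n)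
    (x : Fin n → ℝ) :
    powWeight (b + d) x = powWeight b x * Real.exp (∑ i, d i * logVec x i) := by
  simp only [powWeight, Real.exp_sum, ← Finset.prod_mul_distrib, logVec]
  refine Finset.prod_congr rfl fun i _ => ?_
  rcases eq_or_ne (x i) 0 with hi | hi
  · rw [hi, abs_zero, Real.zero_rpow (hb i trivial).1.ne', Real.zero_rpow (hbd i trivial).1.ne',
      zero_mul]
  · rw [Pi.add_apply, Real.rpow_add (abs_pos.2 hi), Real.rpow_def_of_pos (abs_pos.2 hi) (d i),
      Real.log_abs, mul_comm (d i)]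

lemma powWeight_add_smul {b d : Fin n → ℝ} {u : ℝ} (hb : b ∈ expBox n)
    (hbd : b + u • d ∈ expBox n) (x : Fin n → ℝ) :
    powWeight (b + u • d) x = powWeight b x * Real.exp (u * ∑ i, d i * logVec x i) := by
  rw [powWeight_add hb hbd, Finset.mul_sum]
  simp only [Pi.smul_apply, smul_eq_mul, mul_assoc]

lemma mgf_tilt {ρ : Measure (Fin n → ℝ)} {b d : Fin n → ℝ} {u : ℝ} (hb : b ∈ expBox n) (hbd : b + u • d ∈ expBox n) :
    ProbabilityTheory.mgf (fun x => ∑ i, d i * logVec x i) (tilt ρ b) u =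
      ∫ x, powWeight (b + u • d) x ∂ρ := by
  rw [ProbabilityTheory.mgf, tilt, integral_withDensity_eq_integral_toReal_smul
    (measurable_powWeight b).ennreal_ofReal (Filter.Eventually.of_forall fun _ => by simp)]
  simp only [ENNReal.toReal_ofReal (powWeight_nonneg b _), smul_eq_mul,
    powWeight_add_smul hb hbd]

variable {ρ : Measure (Fin n → ℝ)} [IsFiniteMeasure ρ]

lemma isFiniteMeasure_tilt (hρ : ∫⁻ x, ENNReal.ofReal (e2 x) ∂ρ < ⊤) {b : Fin n → ℝ}
    (hb : b ∈ expBox n) : IsFiniteMeasure (tilt ρ b) :=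
  isFiniteMeasure_withDensity_ofReal (integrable_powWeight hρ hb).hasFiniteIntegral

lemma mem_integrableExpSet_tilt (hρ : ∫⁻ x, ENNReal.ofReal (e2 x) ∂ρ < ⊤) {b d : Fin n → ℝ}
    {u : ℝ} (hb : b ∈ expBox n) (hbd : b + u • d ∈ expBox n) :
    u ∈ ProbabilityTheory.integrableExpSet (fun x => ∑ i, d i * logVec x i) (tilt ρ b) := by
  change Integrable _ _
  rw [tilt, integrable_withDensity_iff_integrable_smul'
    (measurable_powWeight b).ennreal_ofReal (Filter.Eventually.of_forall fun _ => by simp)]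
  refine (integrable_powWeight hρ hbd).congr (Filter.Eventually.of_forall fun x => ?_)
  simp only [ENNReal.toReal_ofReal (powWeight_nonneg b x), smul_eq_mul,
    powWeight_add_smul hb hbd]

lemma isOpen_expBox_line (b d : Fin n → ℝ) : IsOpen {u : ℝ | b + u • d ∈ expBox n} :=
  isOpen_expBox.preimage (by fun_prop)

lemma convex_expBox_line (b d : Fin n → ℝ) : Convex ℝ {u : ℝ | b + u • d ∈ expBox n} := by
  intro u hu v hv s t hs ht hst
  have h := convex_expBox hu hv hs ht hst
  have he : b + (s • u + t • v) • d = s • (b + u • d) + t • (b + v • d) := by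
    conv_lhs => rw [← one_smul ℝ b, ← hst]
    module
  rwa [← he] at h

lemma expBox_line_subset (hρ : ∫⁻ x, ENNReal.ofReal (e2 x) ∂ρ < ⊤) {b d : Fin n → ℝ}
    (hb : b ∈ expBox n) :
    {u : ℝ | b + u • d ∈ expBox n} ⊆ interior
      (ProbabilityTheory.integrableExpSet (fun x => ∑ i, d i * logVec x i) (tilt ρ b)) :=
  interior_maximal (fun _ hu => mem_integrableExpSet_tilt hρ hb hu) (isOpen_expBox_line b d)

lemma analyticOnNhd_integral_powWeight (hρ : ∫⁻ x, ENNReal.ofReal (e2 x) ∂ρ < ⊤)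
    {b d : Fin n → ℝ} (hb : b ∈ expBox n) :
    AnalyticOnNhd ℝ (fun u : ℝ => ∫ x, powWeight (b + u • d) x ∂ρ)
      {u : ℝ | b + u • d ∈ expBox n} := by
  have h := ProbabilityTheory.analyticOnNhd_mgf.mono (expBox_line_subset (d := d) hρ hb)
  exact h.congr (isOpen_expBox_line b d) fun u hu => mgf_tilt hb hu

end Weights

/-- Equality of moment generating functions on an open interval propagates to the vertical strip
above it. -/
lemma complexMGF_eqOn_of_mgf_eqOn {Ω Ω' : Type*} {mΩ : MeasurableSpace Ω}
    {mΩ' : MeasurableSpace Ω'} {X : Ω → ℝ} {Y : Ω' → ℝ} {μ : Measure Ω} {μ' : Measure Ω'}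
    {U : Set ℝ} (hU : IsOpen U) (hc : Convex ℝ U)
    (hX : U ⊆ interior (ProbabilityTheory.integrableExpSet X μ))
    (hY : U ⊆ interior (ProbabilityTheory.integrableExpSet Y μ'))
    (h : Set.EqOn (ProbabilityTheory.mgf X μ) (ProbabilityTheory.mgf Y μ') U) :
    Set.EqOn (ProbabilityTheory.complexMGF X μ) (ProbabilityTheory.complexMGF Y μ')
      {z | z.re ∈ U} := by
  rcases U.eq_empty_or_nonempty with rfl | ⟨t, ht⟩
  · intro z hz
    exact absurd hz (Set.notMem_empty _)
  have hX' : AnalyticOnNhd ℂ (ProbabilityTheory.complexMGF X μ) {z | z.re ∈ U} :=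
    ProbabilityTheory.analyticOnNhd_complexMGF.mono fun z hz => hX hz
  have hY' : AnalyticOnNhd ℂ (ProbabilityTheory.complexMGF Y μ') {z | z.re ∈ U} :=
    ProbabilityTheory.analyticOnNhd_complexMGF.mono fun z hz => hY hz
  refine AnalyticOnNhd.eqOn_of_preconnected_of_frequently_eq hX' hY'
    (hc.linear_preimage Complex.reLm).isPreconnected (z₀ := (t : ℂ)) (by simpa using ht) ?_
  have hf : ∃ᶠ x : ℝ in nhdsWithin t {t}ᶜ,
      ProbabilityTheory.complexMGF X μ x = ProbabilityTheory.complexMGF Y μ' x := by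
    refine Filter.Eventually.frequently ?_
    filter_upwards [nhdsWithin_le_nhds (hU.mem_nhds ht)] with x hx
    rw [ProbabilityTheory.complexMGF_ofReal, ProbabilityTheory.complexMGF_ofReal, h hx]
  refine Filter.Tendsto.frequently (f := ((↑) : ℝ → ℂ)) ?_ hf
  refine tendsto_nhdsWithin_of_tendsto_nhds_of_eventually_within _ ?_ ?_
  · exact (Complex.continuous_ofReal.tendsto t).mono_left nhdsWithin_le_nhds
  · filter_upwards [self_mem_nhdsWithin] with x hx
    simpa using hx

section Reflections

variable {n : ℕ}

lemma mem_setA_univ {x : Fin n → ℝ} : x ∈ setA (Finset.univ : Finset (Fin n)) ↔ ∀ i, x i ≠ 0 := by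
  simp [setA]

lemma measurableSet_setA_univ : MeasurableSet (setA (Finset.univ : Finset (Fin n))) := by
  have : setA (Finset.univ : Finset (Fin n)) = Set.univ.pi fun _ => {0}ᶜ := by
    ext x
    simp [setA]
  rw [this]
  exact MeasurableSet.univ_pi fun _ => (measurableSet_singleton 0).compl

lemma measurable_flipE (E : Finset (Fin n)) : Measurable (flipE E) := by
  refine measurable_pi_lambda _ fun i => ?_
  unfold flipE
  split_ifs
  · exact (measurable_pi_apply i).neg
  · exact measurable_pi_apply i

lemma flipE_flipE (E F : Finset (Fin n)) (x : Fin n → ℝ) :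
    flipE E (flipE F x) = flipE (E ∆ F) x := by
  ext i
  by_cases hE : i ∈ E <;> by_cases hF : i ∈ F <;> simp [flipE, hE, hF, Finset.mem_symmDiff]

lemma flipE_mem_setA_univ (E : Finset (Fin n)) (x : Fin n → ℝ) :
    flipE E x ∈ setA (Finset.univ : Finset (Fin n)) ↔
      x ∈ setA (Finset.univ : Finset (Fin n)) := by
  simp only [mem_setA_univ]
  refine forall_congr' fun i => ?_
  by_cases hE : i ∈ E <;> simp [flipE, hE]

lemma flipE_mul (E : Finset (Fin n)) (x y : Fin n → ℝ) : x * flipE E y = flipE E x * y := by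
  ext i
  by_cases hE : i ∈ E <;> simp [flipE, hE]

/-- A sum over all reflections does not see the signs of the coordinates. -/
lemma sum_flipE_abs {M : Type*} [AddCommMonoid M] (f : (Fin n → ℝ) → M) (x : Fin n → ℝ) :
    ∑ E : Finset (Fin n), f (flipE E fun i => |x i|) = ∑ E : Finset (Fin n), f (flipE E x) := by
  have h : (fun i => |x i|) = flipE (Finset.univ.filter fun i => x i < 0) x := by
    ext i
    by_cases hi : x i < 0
    · simp [flipE, hi, abs_of_neg hi]
    · simp [flipE, hi, abs_of_nonneg (not_lt.1 hi)]
  rw [h]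
  simp only [flipE_flipE]
  exact Equiv.sum_comp (Function.Involutive.toPerm
    (fun E => E ∆ (Finset.univ.filter fun i => x i < 0)) (symmDiff_symmDiff_cancel_right _))
    fun E => f (flipE E x)

lemma Munc_apply (m : SM n) {C : Set (Fin n → ℝ)} (hC : MeasurableSet C) :
    Munc m C = ((2 : ℝ) ^ n)⁻¹ * ∑ E : Finset (Fin n), m (flipE E ⁻¹' C) := by
  rw [Munc, FunLike.coe_smul, Pi.smul_apply, FunLike.coe_sum, Finset.sum_apply, smul_eq_mul]
  simp only [Tmap, VectorMeasure.map_apply _ (measurable_flipE _) hC]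

lemma sum_preimage_flipE_eq (m : SM n) {C : Set (Fin n → ℝ)} (hC : MeasurableSet C) :
    ∑ E : Finset (Fin n), m (flipE E ⁻¹' C) = 2 ^ n * Munc m C := by
  rw [Munc_apply m hC, mul_inv_cancel_left₀ (by positivity)]

lemma Munc_eq_self {m : SM n} (h : ∀ E : Finset (Fin n), Tmap E m = m) : Munc m = m := by
  simp only [Munc, h, Finset.sum_const, Finset.card_univ, Fintype.card_finset, Fintype.card_fin]
  rw [← Nat.cast_smul_eq_nsmul ℝ, smul_smul]
  simp

end Reflections

section Uniqueness

variable {n : ℕ} {P N : Measure (Fin n → ℝ)} [IsFiniteMeasure P] [IsFiniteMeasure N]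

lemma clm_apply_eq_sum (l : StrongDual ℝ (Fin n → ℝ)) (y : Fin n → ℝ) :
    l y = ∑ i, l (Pi.single i 1) * y i := by
  conv_lhs => rw [pi_eq_sum_univ' y]
  simp [mul_comm]

lemma map_logVec_tilt_eq (hP : ∫⁻ x, ENNReal.ofReal (e2 x) ∂P < ⊤)
    (hN : ∫⁻ x, ENNReal.ofReal (e2 x) ∂N < ⊤)
    (h : ∀ b ∈ expBox n, ∫ x, powWeight b x ∂P = ∫ x, powWeight b x ∂N)
    {b : Fin n → ℝ} (hb : b ∈ expBox n) :
    (tilt P b).map logVec = (tilt N b).map logVec := by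
  have := isFiniteMeasure_tilt hP hb
  have := isFiniteMeasure_tilt hN hb
  refine Measure.ext_of_charFunDual (funext fun l => ?_)
  set d : Fin n → ℝ := fun i => l (Pi.single i 1)
  have key := complexMGF_eqOn_of_mgf_eqOn (isOpen_expBox_line b d) (convex_expBox_line b d)
    (expBox_line_subset hP hb) (expBox_line_subset hN hb)
    (fun u hu => by rw [mgf_tilt hb hu, mgf_tilt hb hu, h _ hu])
  have h0 : Complex.I ∈ {z : ℂ | z.re ∈ {u : ℝ | b + u • d ∈ expBox n}} := by simpa using hb
  have hchar : ∀ ρ : Measure (Fin n → ℝ), charFunDual (ρ.map logVec) l =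
      ProbabilityTheory.complexMGF (fun x => ∑ i, d i * logVec x i) ρ Complex.I := by
    intro ρ
    rw [charFunDual_apply, integral_map measurable_logVec.aemeasurable (by fun_prop),
      ProbabilityTheory.complexMGF]
    refine integral_congr_ae (Filter.Eventually.of_forall fun x => ?_)
    dsimp only
    rw [clm_apply_eq_sum l, mul_comm]
  rw [hchar, hchar, key h0]

lemma lintegral_map_logVec_tilt (P : Measure (Fin n → ℝ)) {b : Fin n → ℝ} (hb : b ∈ expBox n)
    {C : Set (Fin n → ℝ)} (hC : MeasurableSet C) :
    ∫⁻ y, (∑ E : Finset (Fin n), C.indicator 1 (flipE E fun i => Real.exp (y i))) *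
        (ENNReal.ofReal (powWeight b fun i => Real.exp (y i)))⁻¹ ∂((tilt P b).map logVec) =
      ∑ E : Finset (Fin n), P (flipE E ⁻¹' (C ∩ setA Finset.univ)) := by
  have hexp : Measurable fun y : Fin n → ℝ => fun i => Real.exp (y i) := by fun_prop
  have hind : Measurable (C.indicator (1 : (Fin n → ℝ) → ℝ≥0∞)) := measurable_one.indicator hC
  have hmeas : Measurable fun y : Fin n → ℝ =>
      (∑ E : Finset (Fin n), C.indicator (1 : (Fin n → ℝ) → ℝ≥0∞)
        (flipE E fun i => Real.exp (y i))) *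
        (ENNReal.ofReal (powWeight b fun i => Real.exp (y i)))⁻¹ := by
    refine Measurable.mul (Finset.measurable_fun_sum _ fun E _ => ?_) ?_
    · exact hind.comp ((measurable_flipE E).comp hexp)
    · exact ((measurable_powWeight b).comp hexp).ennreal_ofReal.inv
  rw [lintegral_map hmeas measurable_logVec]
  refine (lintegral_withDensity_eq_lintegral_mul P (measurable_powWeight b).ennreal_ofReal
    (hmeas.comp measurable_logVec)).trans ?_
  have hsets : ∀ E : Finset (Fin n), MeasurableSet (flipE E ⁻¹' (C ∩ setA Finset.univ)) :=
    fun E => measurable_flipE E (hC.inter measurableSet_setA_univ)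
  simp only [← lintegral_indicator_one (hsets _)]
  rw [← lintegral_finsetSum _ fun E _ => measurable_one.indicator (hsets E)]
  refine lintegral_congr fun x => ?_
  by_cases hx : x ∈ setA (Finset.univ : Finset (Fin n))
  · have hx' := mem_setA_univ.1 hx
    have hlog : (fun i => Real.exp (logVec x i)) = fun i => |x i| :=
      funext fun i => Real.exp_log_eq_abs (hx' i)
    have hw : powWeight b (fun i => |x i|) = powWeight b x := by simp [powWeight]
    have hpos : ENNReal.ofReal (powWeight b x) ≠ 0 := by simpa using powWeight_pos hx'
    simp only [Pi.mul_apply, Function.comp_apply, hlog, hw, sum_flipE_abs]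
    rw [mul_comm, mul_assoc, ENNReal.inv_mul_cancel hpos ENNReal.ofReal_ne_top, mul_one]
    refine Finset.sum_congr rfl fun E _ => ?_
    simp [Set.indicator, flipE_mem_setA_univ, hx]
  · have h0 := powWeight_eq_zero hb fun h => hx (mem_setA_univ.2 h)
    simp [Pi.mul_apply, h0, Set.indicator, flipE_mem_setA_univ, hx]

/-- An integrable signed measure whose power moments all vanish has an unconditional
symmetrisation without mass on the set of vectors with nonzero coordinates. -/
lemma Rres_Munc_eq_zero (hn : 1 ≤ n) {m : SM n} (hm : IntegrableSM m)
    (h : ∀ b ∈ expBox n, sInt m (powWeight b) = 0) : Rres Finset.univ (Munc m) = 0 := by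
  obtain ⟨hP, hN⟩ : (∫⁻ x, ENNReal.ofReal (e2 x) ∂m.toJordanDecomposition.posPart < ⊤) ∧
      ∫⁻ x, ENNReal.ofReal (e2 x) ∂m.toJordanDecomposition.negPart < ⊤ := by
    rwa [IntegrableSM, SignedMeasure.totalVariation, lintegral_add_measure,
      ENNReal.add_lt_top] at hm
  set b : Fin n → ℝ := fun _ => (n : ℝ)⁻¹ / 2
  have hb : b ∈ expBox n := fun i _ => by
    have : (0 : ℝ) < (n : ℝ)⁻¹ := by positivity
    exact ⟨half_pos this, half_lt_self this⟩
  have hmap := map_logVec_tilt_eq hP hN (fun b hb => sub_eq_zero.1 (h b hb)) hb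
  ext C hC
  have hCA := hC.inter (measurableSet_setA_univ (n := n))
  rw [Rres, VectorMeasure.restrict_apply _ measurableSet_setA_univ hC, Munc_apply m hCA]
  have hsum : ∑ E : Finset (Fin n), m.toJordanDecomposition.posPart
        (flipE E ⁻¹' (C ∩ setA Finset.univ)) =
      ∑ E : Finset (Fin n), m.toJordanDecomposition.negPart
        (flipE E ⁻¹' (C ∩ setA Finset.univ)) := by
    rw [← lintegral_map_logVec_tilt _ hb hC, ← lintegral_map_logVec_tilt _ hb hC, hmap]
  have hreal := congrArg ENNReal.toReal hsum
  rw [ENNReal.toReal_sum fun _ _ => measure_ne_top _ _,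
    ENNReal.toReal_sum fun _ _ => measure_ne_top _ _] at hreal
  have hz : ∑ E : Finset (Fin n), m (flipE E ⁻¹' (C ∩ setA Finset.univ)) = 0 := by
    simp only [m.apply_eq_posPart_real_sub_negPart_real (measurable_flipE _ hCA),
      Finset.sum_sub_distrib]
    exact sub_eq_zero.2 hreal
  rw [hz, mul_zero]
  rfl

end Uniqueness

section Convolution

variable {n : ℕ}

lemma toSigned_of_isFiniteMeasure {X : Type*} [MeasurableSpace X] (ρ : Measure X)
    [h : IsFiniteMeasure ρ] : toSigned ρ = ρ.toSignedMeasure := dif_pos h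

lemma measurable_hadamard : Measurable fun p : (Fin n → ℝ) × (Fin n → ℝ) => p.1 * p.2 := by
  fun_prop

instance isFiniteMeasure_mconvPos (ρ σ : Measure (Fin n → ℝ)) [IsFiniteMeasure ρ]
    [IsFiniteMeasure σ] : IsFiniteMeasure (mconvPos ρ σ) := by
  unfold mconvPos
  infer_instance

lemma integrable_powWeight_mconvPos {ρ σ : Measure (Fin n → ℝ)} [IsFiniteMeasure ρ]
    [IsFiniteMeasure σ] {b : Fin n → ℝ} (hρ : Integrable (powWeight b) ρ)
    (hσ : Integrable (powWeight b) σ) : Integrable (powWeight b) (mconvPos ρ σ) := by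
  rw [mconvPos, integrable_map_measure (measurable_powWeight b).aestronglyMeasurable
    measurable_hadamard.aemeasurable]
  exact (hρ.mul_prod hσ).congr
    (Filter.Eventually.of_forall fun p => (powWeight_mul b p.1 p.2).symm)

lemma integral_powWeight_mconvPos (ρ σ : Measure (Fin n → ℝ)) [IsFiniteMeasure ρ]
    [IsFiniteMeasure σ] (b : Fin n → ℝ) :
    ∫ x, powWeight b x ∂(mconvPos ρ σ) = (∫ x, powWeight b x ∂ρ) * ∫ x, powWeight b x ∂σ := by
  rw [mconvPos, integral_map measurable_hadamard.aemeasurable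
    (measurable_powWeight b).aestronglyMeasurable]
  simp only [powWeight_mul]
  exact integral_prod_mul _ _

lemma IntegrableSM.integrable_powWeight {m : SM n} (hm : IntegrableSM m) {b : Fin n → ℝ}
    (hb : b ∈ expBox n) :
    Integrable (powWeight b) m.toJordanDecomposition.posPart ∧
      Integrable (powWeight b) m.toJordanDecomposition.negPart := by
  rw [IntegrableSM, SignedMeasure.totalVariation, lintegral_add_measure,
    ENNReal.add_lt_top] at hm
  exact ⟨_root_.integrable_powWeight hm.1 hb, _root_.integrable_powWeight hm.2 hb⟩

lemma sInt_powWeight_mul_eq_zero {ν μ : SM n} (hν : IntegrableSM ν) (hμ : IntegrableSM μ)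
    (h : mconv ν μ = 0) {b : Fin n → ℝ} (hb : b ∈ expBox n) :
    sInt ν (powWeight b) * sInt μ (powWeight b) = 0 := by
  obtain ⟨hνp, hνn⟩ := hν.integrable_powWeight hb
  obtain ⟨hμp, hμn⟩ := hμ.integrable_powWeight hb
  rw [mconv, toSigned_of_isFiniteMeasure, toSigned_of_isFiniteMeasure, sub_eq_zero,
    Measure.toSignedMeasure_eq_toSignedMeasure_iff] at h
  have hi := congrArg (fun ρ => ∫ x, powWeight b x ∂ρ) h
  rw [integral_add_measure (integrable_powWeight_mconvPos hνp hμp)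
      (integrable_powWeight_mconvPos hνn hμn),
    integral_add_measure (integrable_powWeight_mconvPos hνp hμn)
      (integrable_powWeight_mconvPos hνn hμp)] at hi
  simp only [integral_powWeight_mconvPos] at hi
  rw [sInt, sInt]
  linear_combination hi

/-- The power moments of an integrable signed measure depend analytically on the exponent along
lines. -/
lemma analyticOnNhd_sInt_powWeight {m : SM n} (hm : IntegrableSM m) {b d : Fin n → ℝ}
    (hb : b ∈ expBox n) :
    AnalyticOnNhd ℝ (fun u : ℝ => sInt m (powWeight (b + u • d)))
      {u : ℝ | b + u • d ∈ expBox n} := by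
  rw [IntegrableSM, SignedMeasure.totalVariation, lintegral_add_measure,
    ENNReal.add_lt_top] at hm
  exact (analyticOnNhd_integral_powWeight hm.1 hb).sub (analyticOnNhd_integral_powWeight hm.2 hb)

lemma sInt_powWeight_eq_zero_or {ν μ : SM n} (hν : IntegrableSM ν) (hμ : IntegrableSM μ)
    (h : mconv ν μ = 0) :
    (∀ b ∈ expBox n, sInt ν (powWeight b) = 0) ∨ ∀ b ∈ expBox n, sInt μ (powWeight b) = 0 := by
  by_contra! hcon
  obtain ⟨⟨b, hb, hbν⟩, c, hc, hcμ⟩ := hcon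
  have h0 : b + (0 : ℝ) • (c - b) = b := by simp
  have h1 : b + (1 : ℝ) • (c - b) = c := by simp
  rcases (analyticOnNhd_sInt_powWeight (d := c - b) hν hb).eq_zero_or_eq_zero_of_mul_eq_zero
      (analyticOnNhd_sInt_powWeight (d := c - b) hμ hb)
      (fun u hu => sInt_powWeight_mul_eq_zero hν hμ h hu)
      (convex_expBox_line b (c - b)).isPreconnected with hz | hz
  · have := hz 0 (by simpa using hb)
    rw [h0] at this
    exact hbν this
  · have := hz 1 (by simpa using hc)
    rw [h1] at this
    exact hcμ this

lemma universal_of_Rres_Munc_ne_zero (hn : 1 ≤ n) {ν : SM n} (hν : IntegrableSM ν)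
    (h : Rres Finset.univ (Munc ν) ≠ 0) :
    Universal ν {μ : SM n | IntegrableSM μ ∧ ConcOn μ (setA (Finset.univ : Finset (Fin n))) ∧
      ∀ E : Finset (Fin n), Tmap E μ = μ} := by
  rintro μ ⟨hμ, hconc, hunc⟩ hz
  rcases sInt_powWeight_eq_zero_or hν hμ hz with h0 | h0
  · exact absurd (Rres_Munc_eq_zero hn hν h0) h
  have hR := Rres_Munc_eq_zero hn hμ h0
  rw [Munc_eq_self hunc, Rres] at hR
  ext C hC
  have hA := measurableSet_setA_univ (n := n)
  rw [← VectorMeasure.of_add_of_sdiff (hC.inter hA) hC Set.inter_subset_left,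
    ← VectorMeasure.restrict_apply _ hA hC, hR,
    μ.null_of_totalVariation_zero (measure_mono_null _ hconc)]
  · simp
  · exact fun x hx hxA => hx.2 ⟨hx.1, hxA⟩

end Convolution

section Counterexample

variable {n : ℕ}

/-- Finite linear relations between indicator functions are respected by signed measures. -/
lemma sum_mul_apply_eq_zero {X ι : Type*} [MeasurableSpace X] (m : SignedMeasure X)
    (s : Finset ι) (c : ι → ℝ) {C : ι → Set X} (hC : ∀ j ∈ s, MeasurableSet (C j))
    (h : ∀ x, ∑ j ∈ s, c j * (C j).indicator 1 x = 0) : ∑ j ∈ s, c j * m (C j) = 0 := by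
  have key : ∀ (ρ : Measure X) [IsFiniteMeasure ρ], ∑ j ∈ s, c j * ρ.real (C j) = 0 := by
    intro ρ _
    have hi : ∀ j ∈ s, Integrable (fun x => c j * (C j).indicator 1 x) ρ := fun j hj =>
      ((integrable_const (1 : ℝ)).indicator (hC j hj)).const_mul _
    have := integral_finsetSum s hi
    simp only [h, integral_zero, integral_const_mul] at this
    rw [this]
    exact Finset.sum_congr rfl fun j hj => by rw [integral_indicator_one (hC j hj)]
  rw [Finset.sum_congr rfl fun j hj => by
    rw [m.apply_eq_posPart_real_sub_negPart_real (hC j hj), mul_sub], Finset.sum_sub_distrib,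
    key, key, sub_zero]

/-- The vector with entries `±2` on `F` and `±1` off `F`, the negative ones being those
indexed by `E`. -/
def gridPt (q : Finset (Fin n) × Finset (Fin n)) : Fin n → ℝ :=
  flipE q.2 fun i => if i ∈ q.1 then 2 else 1

lemma gridPt_injective : Function.Injective (gridPt (n := n)) := by
  rintro ⟨F, E⟩ ⟨F', E'⟩ h
  have h' : ∀ i, (i ∈ F ↔ i ∈ F') ∧ (i ∈ E ↔ i ∈ E') := by
    intro i
    have := congrFun h i
    by_cases h1 : i ∈ F <;> by_cases h2 : i ∈ F' <;> by_cases h3 : i ∈ E <;>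
      by_cases h4 : i ∈ E' <;> simp [gridPt, flipE, h1, h2, h3, h4] at this ⊢ <;> norm_num at this
  exact Prod.ext (Finset.ext fun i => (h' i).1) (Finset.ext fun i => (h' i).2)

lemma gridPt_mem_setA_univ (q : Finset (Fin n) × Finset (Fin n)) :
    gridPt q ∈ setA (Finset.univ : Finset (Fin n)) := by
  rw [gridPt, flipE_mem_setA_univ, mem_setA_univ]
  intro i
  split_ifs <;> norm_num

/-- Unit masses at the grid points with index in `s`. -/
def gridMeasure (s : Finset (Finset (Fin n) × Finset (Fin n))) : Measure (Fin n → ℝ) :=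
  ∑ q ∈ s, Measure.dirac (gridPt q)

instance (s : Finset (Finset (Fin n) × Finset (Fin n))) : IsFiniteMeasure (gridMeasure s) := by
  unfold gridMeasure
  infer_instance

lemma gridMeasure_apply_eq_zero {s : Finset (Finset (Fin n) × Finset (Fin n))}
    {C : Set (Fin n → ℝ)} (hC : MeasurableSet C) (h : ∀ q ∈ s, gridPt q ∉ C) :
    gridMeasure s C = 0 := by
  rw [gridMeasure, Measure.finsetSum_apply]
  refine Finset.sum_eq_zero fun q hq => ?_
  rw [Measure.dirac_apply' _ hC, Set.indicator_of_notMem (h q hq)]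

lemma integral_gridMeasure (s : Finset (Finset (Fin n) × Finset (Fin n)))
    (f : (Fin n → ℝ) → ℝ) : ∫ x, f x ∂(gridMeasure s) = ∑ q ∈ s, f (gridPt q) := by
  rw [gridMeasure, integral_finsetSum_measure]
  · exact Finset.sum_congr rfl fun q _ => integral_dirac _ _
  · exact fun q _ => integrable_dirac (by simp)

/-- The grid points on which an even number of entries is `±2`. -/
def evenGrid (n : ℕ) : Finset (Finset (Fin n) × Finset (Fin n)) :=
  Finset.univ.filter fun q => Even q.1.card

/-- The unconditional product of the one-dimensional measures `δ₁ + δ₋₁ - δ₂ - δ₋₂`, in Jordan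
form. -/
def gridJordan (n : ℕ) : JordanDecomposition (Fin n → ℝ) where
  posPart := gridMeasure (evenGrid n)
  negPart := gridMeasure (evenGrid n)ᶜ
  posPart_finite := inferInstance
  negPart_finite := inferInstance
  mutuallySingular := by
    refine ⟨gridPt '' ((evenGrid n)ᶜ : Finset _), (Set.toFinite _).measurableSet, ?_, ?_⟩
    · refine gridMeasure_apply_eq_zero (Set.toFinite _).measurableSet fun q hq hq' => ?_
      rw [gridPt_injective.mem_set_image, Finset.mem_coe, Finset.mem_compl] at hq'
      exact hq' hq
    · exact gridMeasure_apply_eq_zero (Set.toFinite _).measurableSet.compl fun q hq hq' =>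
        hq' (Set.mem_image_of_mem _ hq)

lemma integral_gridJordan (f : (Fin n → ℝ) → ℝ) :
    ∫ x, f x ∂(gridJordan n).posPart - ∫ x, f x ∂(gridJordan n).negPart =
      ∑ F : Finset (Fin n), (-1) ^ F.card * ∑ E : Finset (Fin n), f (gridPt (F, E)) := by
  have h : ∀ q : Finset (Fin n) × Finset (Fin n), (-1 : ℝ) ^ q.1.card * f (gridPt q) =
      if q ∈ evenGrid n then f (gridPt q) else -f (gridPt q) := by
    intro q
    by_cases hq : Even q.1.card
    · simp [evenGrid, hq]
    · simp [evenGrid, hq, (Nat.not_even_iff_odd.1 hq).neg_one_pow]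
  simp only [Finset.mul_sum]
  rw [← Fintype.sum_prod_type' (f := fun F E => (-1 : ℝ) ^ F.card * f (gridPt (F, E)))]
  simp only [h]
  rw [← Finset.sum_add_sum_compl (evenGrid n), Finset.sum_congr rfl fun q hq => if_pos hq,
    Finset.sum_congr (s₁ := (evenGrid n)ᶜ) rfl fun q hq => if_neg (Finset.mem_compl.1 hq),
    Finset.sum_neg_distrib, ← sub_eq_add_neg]
  exact congrArg₂ _ (integral_gridMeasure _ f) (integral_gridMeasure _ f)

lemma gridJordan_toSignedMeasure_apply {C : Set (Fin n → ℝ)} (hC : MeasurableSet C) :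
    (gridJordan n).toSignedMeasure C = ∑ F : Finset (Fin n), (-1) ^ F.card *
      ∑ E : Finset (Fin n), C.indicator (1 : (Fin n → ℝ) → ℝ) (gridPt (F, E)) := by
  rw [JordanDecomposition.toSignedMeasure, Measure.toSignedMeasure_sub_apply hC,
    ← integral_indicator_one hC, ← integral_indicator_one hC, integral_gridJordan]

lemma Tmap_gridJordan (D : Finset (Fin n)) :
    Tmap D (gridJordan n).toSignedMeasure = (gridJordan n).toSignedMeasure := by
  ext C hC
  rw [Tmap, VectorMeasure.map_apply _ (measurable_flipE D) hC,
    gridJordan_toSignedMeasure_apply (measurable_flipE D hC), gridJordan_toSignedMeasure_apply hC]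
  refine Finset.sum_congr rfl fun F _ => congrArg _ ?_
  have h : ∀ E : Finset (Fin n), flipE D (gridPt (F, E)) = gridPt (F, D ∆ E) :=
    fun E => flipE_flipE D E _
  change ∑ E : Finset (Fin n), C.indicator (1 : (Fin n → ℝ) → ℝ) (flipE D (gridPt (F, E))) = _
  simp only [h]
  exact Equiv.sum_comp (Function.Involutive.toPerm (fun E => D ∆ E)
    (symmDiff_symmDiff_cancel_left D))
    fun E => C.indicator (1 : (Fin n → ℝ) → ℝ) (gridPt (F, E))

lemma gridJordan_toSignedMeasure_ne_zero : (gridJordan n).toSignedMeasure ≠ 0 := by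
  intro h
  have h1 : gridJordan n = 0 := by
    rw [← JordanDecomposition.toJordanDecomposition_toSignedMeasure (gridJordan n), h,
      SignedMeasure.toJordanDecomposition_zero]
  have h2 : gridMeasure (evenGrid n) = 0 := congrArg JordanDecomposition.posPart h1
  have h3 := integral_gridMeasure (evenGrid n) fun _ => 1
  rw [h2] at h3
  have h4 : ((∅, ∅) : Finset (Fin n) × Finset (Fin n)) ∈ evenGrid n := by simp [evenGrid]
  simp only [integral_zero_measure, Finset.sum_const, nsmul_eq_mul, mul_one] at h3
  exact Finset.card_ne_zero_of_mem h4 (by exact_mod_cast h3.symm)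

lemma totalVariation_gridJordan : (gridJordan n).toSignedMeasure.totalVariation =
    gridMeasure (evenGrid n) + gridMeasure (evenGrid n)ᶜ := by
  rw [SignedMeasure.totalVariation, JordanDecomposition.toJordanDecomposition_toSignedMeasure]
  rfl

lemma integrableSM_gridJordan : IntegrableSM (gridJordan n).toSignedMeasure := by
  have h : ∀ s : Finset (Finset (Fin n) × Finset (Fin n)),
      ∫⁻ x, ENNReal.ofReal (e2 x) ∂(gridMeasure s) < ⊤ := by
    intro s
    simp only [gridMeasure, lintegral_finsetSum_measure, lintegral_dirac]
    exact ENNReal.sum_lt_top.2 fun q _ => ENNReal.ofReal_lt_top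
  rw [IntegrableSM, totalVariation_gridJordan, lintegral_add_measure]
  exact ENNReal.add_lt_top.2 ⟨h _, h _⟩

lemma concOn_gridJordan :
    ConcOn (gridJordan n).toSignedMeasure (setA (Finset.univ : Finset (Fin n))) := by
  rw [ConcOn, totalVariation_gridJordan, Measure.add_apply,
    gridMeasure_apply_eq_zero measurableSet_setA_univ.compl
      fun q _ hq => hq (gridPt_mem_setA_univ q),
    gridMeasure_apply_eq_zero measurableSet_setA_univ.compl
      fun q _ hq => hq (gridPt_mem_setA_univ q), add_zero]

lemma mconvPos_real_apply (ρ σ : Measure (Fin n → ℝ)) [IsFiniteMeasure ρ] [IsFiniteMeasure σ]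
    {B : Set (Fin n → ℝ)} (hB : MeasurableSet B) :
    (mconvPos ρ σ).real B = ∫ y, ρ.real ((fun x => x * y) ⁻¹' B) ∂σ := by
  have hs : MeasurableSet ((fun p : (Fin n → ℝ) × (Fin n → ℝ) => p.1 * p.2) ⁻¹' B) :=
    measurable_hadamard hB
  rw [measureReal_def, mconvPos, Measure.map_apply measurable_hadamard hB,
    Measure.prod_apply_symm hs, ← integral_toReal (measurable_measure_prodMk_right hs).aemeasurable
      (Filter.Eventually.of_forall fun _ => measure_lt_top _ _)]
  rfl

lemma measurable_mul_right_vec (y : Fin n → ℝ) : Measurable fun x : Fin n → ℝ => x * y := by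
  fun_prop

lemma mconv_gridJordan_apply (ν : SM n) {B : Set (Fin n → ℝ)} (hB : MeasurableSet B) :
    mconv ν (gridJordan n).toSignedMeasure B = ∑ F : Finset (Fin n), (-1) ^ F.card *
      ∑ E : Finset (Fin n), ν ((fun x => x * gridPt (F, E)) ⁻¹' B) := by
  have hν := fun y : Fin n → ℝ =>
    ν.apply_eq_posPart_real_sub_negPart_real (measurable_mul_right_vec y hB)
  rw [mconv, JordanDecomposition.toJordanDecomposition_toSignedMeasure,
    toSigned_of_isFiniteMeasure, toSigned_of_isFiniteMeasure,
    Measure.toSignedMeasure_sub_apply hB, measureReal_add_apply, measureReal_add_apply,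
    mconvPos_real_apply _ _ hB, mconvPos_real_apply _ _ hB, mconvPos_real_apply _ _ hB,
    mconvPos_real_apply _ _ hB]
  simp only [hν, Finset.sum_sub_distrib, mul_sub]
  rw [← integral_gridJordan fun y =>
      ν.toJordanDecomposition.posPart.real ((fun x => x * y) ⁻¹' B),
    ← integral_gridJordan fun y =>
      ν.toJordanDecomposition.negPart.real ((fun x => x * y) ⁻¹' B)]
  ring

lemma mconv_gridJordan_eq_zero {ν : SM n} (h : Rres Finset.univ (Munc ν) = 0) :
    mconv ν (gridJordan n).toSignedMeasure = 0 := by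
  ext B hB
  have hA := measurableSet_setA_univ (n := n)
  set p : Finset (Fin n) → Fin n → ℝ := fun F i => if i ∈ F then 2 else 1 with hp
  have hpB : ∀ F, MeasurableSet ((fun x => x * p F) ⁻¹' B) := fun F =>
    measurable_mul_right_vec (p F) hB
  have hE : ∀ F E : Finset (Fin n), (fun x => x * gridPt (F, E)) ⁻¹' B =
      flipE E ⁻¹' ((fun x => x * p F) ⁻¹' B) := by
    intro F E
    ext x
    change x * flipE E (p F) ∈ B ↔ flipE E x * p F ∈ B
    rw [flipE_mul]
  have hdiff : ∀ C : Set (Fin n → ℝ), MeasurableSet C →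
      Munc ν C = Munc ν (C ∩ (setA Finset.univ)ᶜ) := by
    intro C hC
    rw [← VectorMeasure.of_add_of_sdiff (hC.inter hA) hC Set.inter_subset_left,
      ← VectorMeasure.restrict_apply _ hA hC]
    rw [Rres] at h
    rw [h, Set.sdiff_self_inter, Set.sdiff_eq]
    simp
  rw [mconv_gridJordan_apply ν hB]
  simp only [hE, sum_preimage_flipE_eq ν (hpB _)]
  simp only [hdiff _ (hpB _), mul_left_comm _ ((2 : ℝ) ^ n), ← Finset.mul_sum]
  rw [sum_mul_apply_eq_zero (Munc ν) Finset.univ _ fun F _ => (hpB F).inter hA.compl]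
  · simp
  intro x
  by_cases hx : x ∈ setA (Finset.univ : Finset (Fin n))
  · simp [hx]
  obtain ⟨i, hi⟩ : ∃ i, x i = 0 := by
    simpa [mem_setA_univ] using hx
  refine Finset.sum_involution (fun F _ => F ∆ {i}) (fun F _ => ?_) (fun F _ _ => ?_)
    (fun _ _ => Finset.mem_univ _) (fun F _ => symmDiff_symmDiff_cancel_right _ _)
  · have hmul : x * p (F ∆ {i}) = x * p F := by
      ext j
      rcases eq_or_ne j i with rfl | hj
      · simp [hi]
      · simp [hp, Finset.mem_symmDiff, hj]
    have hsign : (-1 : ℝ) ^ (F ∆ {i}).card = -(-1) ^ F.card := by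
      by_cases hiF : i ∈ F
      · have : F ∆ {i} = F.erase i := by
          ext j
          by_cases hj : j = i <;> simp [Finset.mem_symmDiff, hj, hiF]
        rw [this, ← Finset.card_erase_add_one hiF, pow_succ]
        ring
      · have : F ∆ {i} = insert i F := by
          ext j
          by_cases hj : j = i <;> simp [Finset.mem_symmDiff, hj, hiF]
        rw [this, Finset.card_insert_of_notMem hiF, pow_succ]
        ring
    by_cases hxB : x * p F ∈ B <;> simp [Set.indicator, hmul, hsign, hx, hxB]
  · intro hF
    have : ({i} : Finset (Fin n)) = ∅ := symmDiff_eq_left.1 hF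
    exact Finset.singleton_ne_empty i this

end Counterexample

/-- Theorem: `ν` is universal on the integrable unconditional measures concentrated on
`A_{[n]}` iff `M_unc(ν)` has degree `n`, i.e. `(M_unc ν)_{[n]} ≠ 0`. -/
theorem stmt2 {n : ℕ} (hn : 1 ≤ n) (ν : SM n) (hint : IntegrableSM ν) :
    Universal ν {μ : SM n | IntegrableSM μ ∧
        ConcOn μ (setA (Finset.univ : Finset (Fin n))) ∧
        ∀ E : Finset (Fin n), Tmap E μ = μ} ↔
      Rres (Finset.univ : Finset (Fin n)) (Munc ν) ≠ 0 := by
  refine ⟨fun hU h0 => ?_, universal_of_Rres_Munc_ne_zero hn hint⟩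
  exact gridJordan_toSignedMeasure_ne_zero (hU _
    ⟨integrableSM_gridJordan, concOn_gridJordan, Tmap_gridJordan⟩ (mconv_gridJordan_eq_zero h0))

end
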